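/- (Factorial decay of the signature.) Fix d ≥ 1, T > 0 and functions f i : ℝ → ℝ (i ∈ Fin d) integrable on [0,T], and let h be the iterated integrals of f. Set V = ∫_0^T ‖f(s)‖ ds, where ‖f(s)‖ = (Σ_{i} f i (s)²)^{1/2} is the Euclidean norm. Then for every n ∈ ℕ, ( Σ_{w : |w| = n} (h w 0 T)² )^{1/2} ≤ V^n / n!, the sum being over all words of length n. In particular, for every single word w of length n, |h w 0 T| ≤ (Σ_i ∫_0^T |f i (s)| ds)^n / n!. -/

import Mathlib

open MeasureTheory intervalIntegral

lemma intervalIntegrable_sqrt_sum_sq {ι : Type*} [Fintype ι] {g : ι → ℝ → ℝ} {a b : ℝ}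
    (hg : ∀ i, IntervalIntegrable (g i) volume a b) :
    IntervalIntegrable (fun u => √(∑ i, g i u ^ 2)) volume a b := by
  have hG : Integrable (fun u => WithLp.toLp 2 fun i => g i u)
      (volume.restrict (Set.uIoc a b)) :=
    Integrable.of_eval_piLp fun i => intervalIntegrable_iff.mp (hg i)
  rw [intervalIntegrable_iff]
  simpa [EuclideanSpace.norm_eq, IntegrableOn] using hG.norm

/-- Minkowski's integral inequality for finitely many real functions and the Euclidean norm. -/
lemma sqrt_sum_sq_integral_le {ι : Type*} [Fintype ι] {g : ι → ℝ → ℝ} {a b : ℝ} (hab : a ≤ b)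
    (hg : ∀ i, IntervalIntegrable (g i) volume a b) :
    √(∑ i, (∫ u in a..b, g i u) ^ 2) ≤ ∫ u in a..b, √(∑ i, g i u ^ 2) := by
  have hG (i : ι) : Integrable (fun u => (WithLp.toLp 2 fun i => g i u : EuclideanSpace ℝ ι) i)
      (volume.restrict (Set.Ioc a b)) :=
    (intervalIntegrable_iff_integrableOn_Ioc_of_le hab).mp (hg i)
  have key := norm_integral_le_integral_norm (μ := volume.restrict (Set.Ioc a b))
    (fun u => (WithLp.toLp 2 fun i => g i u : EuclideanSpace ℝ ι))
  simp only [integral_of_le hab]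
  simpa [EuclideanSpace.norm_eq, eval_integral_piLp hG] using key

lemma AbsolutelyContinuousOnInterval.fun_pow {F : ℝ → ℝ} {a b : ℝ}
    (hF : AbsolutelyContinuousOnInterval F a b) (n : ℕ) :
    AbsolutelyContinuousOnInterval (fun x => F x ^ (n + 1)) a b := by
  induction n with
  | zero => simpa using hF
  | succ n ih => simpa only [pow_succ _ (n + 1)] using ih.fun_mul hF

lemma integral_primitive_pow_mul {v : ℝ → ℝ} {a b : ℝ} (hv : IntervalIntegrable v volume a b)
    (n : ℕ) :
    ∫ u in a..b, (∫ s in a..u, v s) ^ n * v u = (∫ s in a..b, v s) ^ (n + 1) / (n + 1) := by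
  have hac := hv.absolutelyContinuousOnInterval_intervalIntegral (c := a) (by simp)
  have key := (hac.fun_pow n).integral_deriv_eq_sub
  simp only [integral_same, zero_pow n.succ_ne_zero, sub_zero] at key
  have hn : (n + 1 : ℝ) ≠ 0 := by positivity
  rw [eq_div_iff hn, ← key, ← intervalIntegral.integral_mul_const]
  apply intervalIntegral.integral_congr_ae
  filter_upwards [hv.ae_hasDerivAt_integral] with x hx hxm
  have hd := (hx (Set.uIoc_subset_uIcc hxm) a (by simp)).fun_pow (n + 1)
  rw [hd.deriv]
  push_cast
  ring

section IteratedIntegrals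

variable {d : ℕ} {T : ℝ} {f : Fin d → ℝ → ℝ} {h : List (Fin d) → ℝ → ℝ → ℝ}

lemma continuousOn_iteratedIntegral (hT : 0 ≤ T)
    (hf : ∀ i, IntervalIntegrable (f i) volume 0 T) (hnil : ∀ s t : ℝ, h [] s t = 1)
    (hrec : ∀ (w : List (Fin d)) (i : Fin d) (s t : ℝ), 0 ≤ s → s ≤ t → t ≤ T →
      h (w ++ [i]) s t = ∫ u in s..t, h w s u * f i u)
    (w : List (Fin d)) : ContinuousOn (h w 0) (Set.uIcc 0 T) := by
  induction w using List.reverseRecOn with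
  | nil => exact continuousOn_const.congr fun t _ => hnil 0 t
  | append_singleton w i ih =>
    refine (continuousOn_primitive_interval'
      ((hf i).continuousOn_mul ih) Set.left_mem_uIcc).congr fun t ht => ?_
    rw [Set.uIcc_of_le hT] at ht
    exact hrec w i 0 t le_rfl ht.1 ht.2

lemma sqrt_sum_sq_iteratedIntegral_le (hT : 0 ≤ T)
    (hf : ∀ i, IntervalIntegrable (f i) volume 0 T) (hnil : ∀ s t : ℝ, h [] s t = 1)
    (hrec : ∀ (w : List (Fin d)) (i : Fin d) (s t : ℝ), 0 ≤ s → s ≤ t → t ≤ T →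
      h (w ++ [i]) s t = ∫ u in s..t, h w s u * f i u)
    (n : ℕ) {t : ℝ} (ht : t ∈ Set.Icc 0 T) :
    √(∑ w : Fin n → Fin d, h (List.ofFn w) 0 t ^ 2)
      ≤ (∫ s in (0 : ℝ)..t, √(∑ i, f i s ^ 2)) ^ n / n.factorial := by
  induction n generalizing t with
  | zero => simp [hnil]
  | succ n ih =>
    have hsub : Set.uIcc 0 t ⊆ Set.uIcc 0 T := by
      rw [Set.uIcc_of_le ht.1, Set.uIcc_of_le hT]
      exact Set.Icc_subset_Icc_right ht.2
    have hft (i : Fin d) : IntervalIntegrable (f i) volume 0 t := (hf i).mono_set hsub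
    have hc (w : List (Fin d)) : ContinuousOn (h w 0) (Set.uIcc 0 t) :=
      (continuousOn_iteratedIntegral hT hf hnil hrec w).mono hsub
    have hv := intervalIntegrable_sqrt_sum_sq hft
    have hvac := hv.absolutelyContinuousOnInterval_intervalIntegral (c := 0) (by simp)
    have hstep : ∑ w : Fin (n + 1) → Fin d, h (List.ofFn w) 0 t ^ 2 =
        ∑ p : Fin d × (Fin n → Fin d), (∫ u in (0 : ℝ)..t, h (List.ofFn p.2) 0 u * f p.1 u) ^ 2 := by
      rw [← (Fin.snocEquiv fun _ => Fin d).sum_comp]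
      refine Finset.sum_congr rfl fun p _ => ?_
      rw [← hrec _ _ 0 t le_rfl ht.1 ht.2, List.ofFn_succ']
      simp [Fin.snocEquiv, List.concat_eq_append]
    have hprod (u : ℝ) : √(∑ p : Fin d × (Fin n → Fin d), (h (List.ofFn p.2) 0 u * f p.1 u) ^ 2) =
        √(∑ w : Fin n → Fin d, h (List.ofFn w) 0 u ^ 2) * √(∑ i, f i u ^ 2) := by
      rw [← Real.sqrt_mul (by positivity), Finset.sum_mul_sum, Fintype.sum_prod_type_right]
      simp only [mul_pow]
    calc √(∑ w : Fin (n + 1) → Fin d, h (List.ofFn w) 0 t ^ 2)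
        ≤ ∫ u in (0 : ℝ)..t,
            √(∑ w : Fin n → Fin d, h (List.ofFn w) 0 u ^ 2) * √(∑ i, f i u ^ 2) := by
          rw [hstep]
          simp only [← hprod]
          exact sqrt_sum_sq_integral_le ht.1 fun p => (hft p.1).continuousOn_mul (hc _)
      _ ≤ ∫ u in (0 : ℝ)..t,
            (∫ s in (0 : ℝ)..u, √(∑ i, f i s ^ 2)) ^ n / n.factorial * √(∑ i, f i u ^ 2) := by
          refine integral_mono_on ht.1 (hv.continuousOn_mul ?_) (hv.continuousOn_mul ?_) ?_
          · exact (continuousOn_finsetSum _ fun w _ => (hc _).pow 2).sqrt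
          · exact (hvac.continuousOn.pow n).div_const _
          · intro u hu
            gcongr
            exact ih ⟨hu.1, hu.2.trans ht.2⟩
      _ = _ := by
          simp only [div_mul_eq_mul_div]
          rw [intervalIntegral.integral_div, integral_primitive_pow_mul hv, Nat.factorial_succ,
            div_div]
          push_cast
          rfl

end IteratedIntegrals

/-- **Factorial decay of the signature.** With
`V = ∫_0^T (∑ᵢ f i (s)²)^{1/2} ds`, the Euclidean norm of the level-`n` part of the
signature satisfies `(∑_{|w| = n} (h w 0 T)²)^{1/2} ≤ Vⁿ/n!`; in particular each single
iterated integral satisfies `|h w 0 T| ≤ (∑ᵢ ∫_0^T |f i|)ⁿ/n!`. -/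
theorem signature_factorial_decay
    (d : ℕ) (hd : 1 ≤ d) (T : ℝ) (hT : 0 < T)
    (f : Fin d → ℝ → ℝ)
    (hf : ∀ i, IntervalIntegrable (f i) volume 0 T)
    (h : List (Fin d) → ℝ → ℝ → ℝ)
    (hnil : ∀ s t : ℝ, h [] s t = 1)
    (hrec : ∀ (w : List (Fin d)) (i : Fin d) (s t : ℝ), 0 ≤ s → s ≤ t → t ≤ T →
      h (w ++ [i]) s t = ∫ u in s..t, h w s u * f i u)
    (n : ℕ) :
    Real.sqrt (∑' w : {w : List (Fin d) // w.length = n}, (h w.1 0 T) ^ 2)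
      ≤ (∫ s in (0 : ℝ)..T, Real.sqrt (∑ i : Fin d, f i s ^ 2)) ^ n / n.factorial ∧
    ∀ w : List (Fin d), w.length = n →
      |h w 0 T| ≤ (∑ i : Fin d, ∫ s in (0 : ℝ)..T, |f i s|) ^ n / n.factorial := by
  have hlevel : Real.sqrt (∑' w : {w : List (Fin d) // w.length = n}, (h w.1 0 T) ^ 2)
      = √(∑ w : Fin n → Fin d, h (List.ofFn w) 0 T ^ 2) := by
    let e : (Fin n → Fin d) ≃ {w : List (Fin d) // w.length = n} :=
      (Equiv.vectorEquivFin (Fin d) n).symm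
    rw [← e.tsum_eq, tsum_fintype]
    congr 1
    refine Finset.sum_congr rfl fun g _ => ?_
    exact congrArg (fun w => h w 0 T ^ 2) (List.Vector.toList_ofFn g)
  have hbound := sqrt_sum_sq_iteratedIntegral_le hT.le hf hnil hrec n ⟨hT.le, le_rfl⟩
  refine ⟨hlevel.trans_le hbound, fun w hw => ?_⟩
  subst hw
  calc |h w 0 T| = √(h (List.ofFn w.get) 0 T ^ 2) := by rw [List.ofFn_get, Real.sqrt_sq_eq_abs]
    _ ≤ √(∑ g : Fin w.length → Fin d, h (List.ofFn g) 0 T ^ 2) :=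
        Real.sqrt_le_sqrt (Finset.single_le_sum
          (f := fun g : Fin w.length → Fin d => h (List.ofFn g) 0 T ^ 2)
          (fun _ _ => sq_nonneg _) (Finset.mem_univ _))
    _ ≤ (∫ s in (0 : ℝ)..T, √(∑ i, f i s ^ 2)) ^ w.length / w.length.factorial := hbound
    _ ≤ (∑ i : Fin d, ∫ s in (0 : ℝ)..T, |f i s|) ^ w.length / w.length.factorial := by
        have h0 : 0 ≤ ∫ s in (0 : ℝ)..T, √(∑ i, f i s ^ 2) :=
          integral_nonneg hT.le fun _ _ => Real.sqrt_nonneg _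
        gcongr
        rw [← intervalIntegral.integral_finsetSum fun i _ => (hf i).abs]
        refine integral_mono_on hT.le (intervalIntegrable_sqrt_sum_sq hf)
          (by simpa only [Finset.sum_fn] using
            IntervalIntegrable.sum Finset.univ fun i _ => (hf i).abs) fun s _ => ?_
        refine Real.sqrt_le_iff.mpr ⟨by positivity, ?_⟩
        simpa only [sq_abs] using Finset.sum_sq_le_sq_sum_of_nonneg
          (s := Finset.univ) (f := fun i => |f i s|) fun i _ => abs_nonneg _
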